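/- Let G be a finite simple graph, let M be a matching in G, let k be a positive even integer, and let e be an edge of G. Suppose that every augmenting path in G with respect to M that does not contain the edge e has length at least k + 1. Let P be an augmenting path in G with respect to M that contains e, has length at most k − 1, and has minimum length among all augmenting paths with respect to M that contain e. Then every augmenting path in G with respect to M△P has length at least k + 1. -/

import Mathlib

open scoped Classical symmDiff

/-- `M` is a matching in the simple graph `G`: a set of edges of `G`
no two of which share an endpoint. -/
def IsMatching {V : Type*} (G : SimpleGraph V) (M : Finset (Sym2 V)) : Prop :=
  (M : Set (Sym2 V)) ⊆ G.edgeSet ∧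
    ∀ e ∈ M, ∀ f ∈ M, e ≠ f → ∀ v : V, v ∈ e → v ∉ f

/-- A vertex is matched by `M` if it is an endpoint of some edge of `M`. -/
def Matched {V : Type*} (M : Finset (Sym2 V)) (v : V) : Prop :=
  ∃ e ∈ M, v ∈ e

/-- A list of edges alternates with respect to the matching `M`. -/
def Alternating {V : Type*} (M : Finset (Sym2 V)) (l : List (Sym2 V)) : Prop :=
  ∀ (i : ℕ) (h : i + 1 < l.length), ((l[i]'(by omega)) ∈ M ↔ (l[i + 1]'h) ∉ M)

/-- `p` is an augmenting path in `G` with respect to the matching `M`: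
a path with at least one edge, both of whose endpoints are exposed, and whose
edges alternate between edges not in `M` and edges in `M`. -/
structure IsAugPath {V : Type*} (G : SimpleGraph V) (M : Finset (Sym2 V))
    {a b : V} (p : G.Walk a b) : Prop where
  isPath : p.IsPath
  pos : 0 < p.length
  expA : ¬ Matched M a
  expB : ¬ Matched M b
  alt : Alternating M p.edges

/-- Two edges of a matching with a common endpoint are equal. -/
theorem IsMatching.eq_of_mem {V : Type*} {G : SimpleGraph V} {M : Finset (Sym2 V)}
    (hM : IsMatching G M) {e f : Sym2 V} (he : e ∈ M) (hf : f ∈ M) {v : V}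
    (hve : v ∈ e) (hvf : v ∈ f) : e = f := by
  by_contra h
  exact hM.2 e he f hf h v hve hvf

theorem alternating_cons_cons {V : Type*} {M : Finset (Sym2 V)} {x y : Sym2 V}
    {l : List (Sym2 V)} :
    Alternating M (x :: y :: l) ↔ (x ∈ M ↔ y ∉ M) ∧ Alternating M (y :: l) := by
  constructor
  · intro h
    refine ⟨by simpa using h 0 (by simp), fun i hi => ?_⟩
    exact h (i + 1) (by simpa using hi)
  · rintro ⟨h0, h⟩ i hi
    cases i with
    | zero => simpa using h0
    | succ i => exact h i (by simpa using hi)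

theorem Alternating.congr {V : Type*} {M N : Finset (Sym2 V)} {l : List (Sym2 V)}
    (h : Alternating M l) (hMN : ∀ f ∈ l, f ∈ M ↔ f ∈ N) : Alternating N l := by
  intro i hi
  rw [← hMN _ (List.getElem_mem _), ← hMN _ (List.getElem_mem _)]
  exact h i hi

theorem IsAugPath.ne {V : Type*} {G : SimpleGraph V} {M : Finset (Sym2 V)} {a b : V}
    {p : G.Walk a b} (hp : IsAugPath G M p) : a ≠ b := by
  rintro rfl
  exact hp.pos.ne' (SimpleGraph.Walk.length_eq_zero_iff.2
    (SimpleGraph.Walk.isPath_iff_nil.1 hp.isPath))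

/-- Adding to a matching an edge with both endpoints exposed. -/
theorem IsMatching.insert_edge {V : Type*} {G : SimpleGraph V} {M N : Finset (Sym2 V)}
    (hM : IsMatching G M) {a b : V} (hab : G.Adj a b) (ha : ¬ Matched M a)
    (hb : ¬ Matched M b) (hN : ∀ f, f ∈ N ↔ f = s(a, b) ∨ f ∈ M) :
    IsMatching G N ∧ ∀ v, Matched N v ↔ Matched M v ∨ v = a ∨ v = b := by
  refine ⟨⟨?_, ?_⟩, ?_⟩
  · intro f hf
    rcases (hN f).1 hf with rfl | hf
    · exact hab
    · exact hM.1 hf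
  · intro f hf g hg hfg v hvf hvg
    rcases (hN f).1 hf with rfl | hf <;> rcases (hN g).1 hg with rfl | hg
    · exact hfg rfl
    · rcases Sym2.mem_iff.1 hvf with rfl | rfl
      · exact ha ⟨g, hg, hvg⟩
      · exact hb ⟨g, hg, hvg⟩
    · rcases Sym2.mem_iff.1 hvg with rfl | rfl
      · exact ha ⟨f, hf, hvf⟩
      · exact hb ⟨f, hf, hvf⟩
    · exact hM.2 f hf g hg hfg v hvf hvg
  · intro v
    constructor
    · rintro ⟨f, hf, hv⟩
      rcases (hN f).1 hf with rfl | hf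
      · exact Or.inr (Sym2.mem_iff.1 hv)
      · exact Or.inl ⟨f, hf, hv⟩
    · rintro (⟨f, hf, hv⟩ | hv)
      · exact ⟨f, (hN f).2 (Or.inr hf), hv⟩
      · exact ⟨s(a, b), (hN _).2 (Or.inl rfl), Sym2.mem_iff.2 hv⟩

/-- Replacing the matching edge `bc` by the edge `ab`, where `a` is exposed, gives a matching
in which `a` is matched and `c` is exposed, other vertices being unaffected. -/
theorem IsMatching.shift {V : Type*} {G : SimpleGraph V} {M N : Finset (Sym2 V)}
    (hM : IsMatching G M) {a b c : V} (hab : G.Adj a b) (ha : ¬ Matched M a)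
    (hbc : s(b, c) ∈ M) (hN : ∀ f, f ∈ N ↔ f = s(a, b) ∨ (f ∈ M ∧ f ≠ s(b, c))) :
    IsMatching G N ∧ ∀ v, Matched N v ↔ v = a ∨ (Matched M v ∧ v ≠ c) := by
  have hbc' : b ≠ c := G.ne_of_adj (hM.1 hbc)
  have hac : a ≠ c := by
    rintro rfl
    exact ha ⟨_, hbc, Sym2.mem_mk_right _ _⟩
  have key : ∀ g ∈ M, g ≠ s(b, c) → ∀ v ∈ s(a, b), v ∉ g := by
    intro g hg hne v hv hvg
    rcases Sym2.mem_iff.1 hv with rfl | rfl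
    · exact ha ⟨g, hg, hvg⟩
    · exact hne (hM.eq_of_mem hg hbc hvg (Sym2.mem_mk_left _ _))
  refine ⟨⟨?_, ?_⟩, ?_⟩
  · intro f hf
    rcases (hN f).1 hf with rfl | hf
    · exact hab
    · exact hM.1 hf.1
  · intro f hf g hg hfg v hvf hvg
    rcases (hN f).1 hf with rfl | hf <;> rcases (hN g).1 hg with rfl | hg
    · exact hfg rfl
    · exact key g hg.1 hg.2 v hvf hvg
    · exact key f hf.1 hf.2 v hvg hvf
    · exact hM.2 f hf.1 g hg.1 hfg v hvf hvg
  · intro v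
    constructor
    · rintro ⟨f, hf, hv⟩
      rcases (hN f).1 hf with rfl | hf
      · rcases Sym2.mem_iff.1 hv with rfl | rfl
        · exact Or.inl rfl
        · exact Or.inr ⟨⟨_, hbc, Sym2.mem_mk_left _ _⟩, hbc'⟩
      · refine Or.inr ⟨⟨f, hf.1, hv⟩, ?_⟩
        rintro rfl
        exact hf.2 (hM.eq_of_mem hf.1 hbc hv (Sym2.mem_mk_right _ _))
    · rintro (rfl | ⟨⟨f, hf, hv⟩, hvc⟩)
      · exact ⟨s(v, b), (hN _).2 (Or.inl rfl), Sym2.mem_mk_left _ _⟩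
      · by_cases hfb : f = s(b, c)
        · subst hfb
          rcases Sym2.mem_iff.1 hv with rfl | rfl
          · exact ⟨s(a, v), (hN _).2 (Or.inl rfl), Sym2.mem_mk_right _ _⟩
          · exact absurd rfl hvc
        · exact ⟨f, (hN f).2 (Or.inr ⟨hf, hfb⟩), hv⟩

/-- Augmenting a matching along an augmenting path gives a matching which matches exactly the
endpoints of the path in addition. -/
theorem IsAugPath.isMatching_symmDiff {V : Type*} {G : SimpleGraph V} {M N : Finset (Sym2 V)}
    {a b : V} {p : G.Walk a b} (hp : IsAugPath G M p) (hM : IsMatching G M)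
    (hN : ∀ f, f ∈ N ↔ ¬ (f ∈ M ↔ f ∈ p.edges)) :
    IsMatching G N ∧ ∀ v, Matched N v ↔ Matched M v ∨ v = a ∨ v = b := by
  induction hn : p.length using Nat.strong_induction_on generalizing M a b with
  | _ n ih =>
  match p, hp, hN, hn with
  | .nil, hp, _, _ => exact absurd hp.pos (by simp)
  | .cons hab .nil, hp, hN, _ =>
    refine hM.insert_edge hab hp.expA hp.expB fun f => ?_
    have : s(a, b) ∉ M := fun h => hp.expA ⟨_, h, Sym2.mem_mk_left _ _⟩
    rw [hN]
    simp only [SimpleGraph.Walk.edges_cons, SimpleGraph.Walk.edges_nil, List.mem_singleton]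
    grind
  | .cons (v := u) hab (.cons (v := c) huc p), hp, hN, hn =>
    have hpath := hp.isPath
    have halt := hp.alt
    have hab' : s(a, u) ∉ M := fun h => hp.expA ⟨_, h, Sym2.mem_mk_left _ _⟩
    simp only [SimpleGraph.Walk.cons_isPath_iff, SimpleGraph.Walk.support_cons,
      List.mem_cons, not_or] at hpath
    obtain ⟨⟨hpp, hup⟩, hau, hap⟩ := hpath
    simp only [SimpleGraph.Walk.edges_cons, alternating_cons_cons] at halt hN
    have hucM : s(u, c) ∈ M := by
      by_contra h
      exact hab' (halt.1.2 h)
    have hua : s(a, u) ∉ p.edges := fun h => hup (p.snd_mem_support_of_mem_edges h)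
    have hucp : s(u, c) ∉ p.edges := fun h => hup (p.fst_mem_support_of_mem_edges h)
    have hbc : b ≠ c := by
      rintro rfl
      exact hp.expB ⟨_, hucM, Sym2.mem_mk_right _ _⟩
    have hba := hp.ne
    have hac : a ≠ c := by
      rintro rfl
      exact hap p.start_mem_support
    have hL : ∀ f, f ∈ insert s(a, u) (M.erase s(u, c)) ↔
        f = s(a, u) ∨ (f ∈ M ∧ f ≠ s(u, c)) := by
      intro f
      simp [and_comm]
    generalize insert s(a, u) (M.erase s(u, c)) = L at hL
    obtain ⟨hLm, hLv⟩ := hM.shift hab hp.expA hucM hL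
    have hq : IsAugPath G L p := by
      refine ⟨hpp, ?_, ?_, ?_, ?_⟩
      · by_contra h
        exact hbc (SimpleGraph.Walk.eq_of_length_eq_zero (p := p) (by omega)).symm
      · rw [hLv]
        grind
      · have := hp.expB
        rw [hLv]
        grind
      · have : Alternating M p.edges := by
          intro i hi
          exact halt.2 (i + 1) (by simpa using hi)
        refine this.congr fun f hf => ?_
        rw [hL]
        grind
    obtain ⟨h1, h2⟩ := ih p.length (by simp at hn; omega) hq hLm (by
      intro f
      rw [hN, hL]
      simp only [List.mem_cons]
      grind) rfl
    refine ⟨h1, fun v => ?_⟩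
    rw [h2, hLv]
    have : Matched M c := ⟨_, hucM, Sym2.mem_mk_right _ _⟩
    grind

/-- If every vertex matched by `M` is matched by `N`, then from every vertex matched by `N` only
there starts an augmenting path with respect to `M` inside the symmetric difference. -/
theorem IsMatching.exists_isAugPath {V : Type*} {G : SimpleGraph V} {M N : Finset (Sym2 V)}
    (hM : IsMatching G M) (hN : IsMatching G N) (hMN : ∀ v, Matched M v → Matched N v)
    {a : V} (haM : ¬ Matched M a) (haN : Matched N a) :
    ∃ (b : V) (p : G.Walk a b), IsAugPath G M p ∧ ∀ f ∈ p.edges, ¬ (f ∈ M ↔ f ∈ N) := by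
  induction hn : (M \ N).card using Nat.strong_induction_on generalizing M a with
  | _ n ih =>
  obtain ⟨f, hf, haf⟩ := haN
  obtain ⟨u, rfl⟩ := Sym2.mem_iff_exists.1 haf
  have hab : G.Adj a u := hN.1 hf
  have hauM : s(a, u) ∉ M := fun h => haM ⟨_, h, Sym2.mem_mk_left _ _⟩
  by_cases hu : Matched M u
  · obtain ⟨g, hg, hug⟩ := hu
    obtain ⟨c, rfl⟩ := Sym2.mem_iff_exists.1 hug
    have hac : a ≠ c := by
      rintro rfl
      exact haM ⟨_, hg, Sym2.mem_mk_right _ _⟩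
    have hucN : s(u, c) ∉ N := by
      intro h
      have := hN.eq_of_mem hf h (Sym2.mem_mk_right _ _) (Sym2.mem_mk_left _ _)
      rw [Sym2.eq_swap] at this
      exact hac (Sym2.congr_right.1 this)
    have huc : G.Adj u c := hM.1 hg
    have hL : ∀ f, f ∈ insert s(a, u) (M.erase s(u, c)) ↔
        f = s(a, u) ∨ (f ∈ M ∧ f ≠ s(u, c)) := by
      intro f
      simp [and_comm]
    generalize insert s(a, u) (M.erase s(u, c)) = L at hL
    obtain ⟨hLm, hLv⟩ := hM.shift hab haM hg hL
    have hcM : Matched M c := ⟨_, hg, Sym2.mem_mk_right _ _⟩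
    have hcard : (L \ N).card < n := by
      rw [← hn]
      refine Finset.card_lt_card (Finset.ssubset_iff_of_subset ?_ |>.2 ⟨s(u, c), ?_, ?_⟩)
      · intro f
        simp only [Finset.mem_sdiff, hL]
        grind
      · simp [hg, hucN]
      · simp only [Finset.mem_sdiff, hL]
        grind
    obtain ⟨b, p, hp, hpe⟩ := ih _ hcard hLm (by
      intro v hv
      rcases (hLv v).1 hv with rfl | hv
      · exact ⟨_, hf, haf⟩
      · exact hMN v hv.1) (by rw [hLv]; grind) (hMN c hcM) rfl
    have hauL : s(a, u) ∈ L := (hL _).2 (Or.inl rfl)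
    have hoff : ∀ v ∈ s(a, u), v ∉ p.support := by
      intro v hv hvp
      have hnil : ¬ p.Nil := by
        rw [← SimpleGraph.Walk.length_eq_zero_iff]
        exact hp.pos.ne'
      obtain ⟨f, hfp, hvf⟩ :=
        (SimpleGraph.Walk.mem_support_iff_exists_mem_edges_of_not_nil hnil).1 hvp
      refine hpe f hfp ⟨fun h => ?_, fun h => ?_⟩
      · rwa [hLm.eq_of_mem h hauL hvf hv]
      · rwa [hN.eq_of_mem h hf hvf hv]
    have hap : a ∉ p.support := hoff a (Sym2.mem_mk_left _ _)
    have hup : u ∉ p.support := hoff u (Sym2.mem_mk_right _ _)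
    have hua : s(a, u) ∉ p.edges := fun h => hup (p.snd_mem_support_of_mem_edges h)
    have hucp : s(u, c) ∉ p.edges := fun h => hup (p.fst_mem_support_of_mem_edges h)
    have hbc := hp.ne
    have hag : ∀ f ∈ p.edges, f ∈ L ↔ f ∈ M := by
      intro f hf
      rw [hL]
      grind
    refine ⟨b, .cons hab (.cons huc p), ⟨?_, by simp, haM, ?_, ?_⟩, ?_⟩
    · simp [SimpleGraph.Walk.cons_isPath_iff, hp.isPath, hap, hup, hab.ne]
    · intro h
      exact hp.expB ((hLv b).2 (Or.inr ⟨h, hbc.symm⟩))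
    · have halt := hp.alt.congr hag
      cases p with
      | nil => exact absurd rfl hbc
      | cons hcd p =>
        simp only [SimpleGraph.Walk.edges_cons, alternating_cons_cons] at halt ⊢
        refine ⟨by simp [hauM, hg], ?_, halt⟩
        simp only [hg, true_iff]
        rw [← hag _ (by simp)]
        exact fun h => hp.expA ⟨_, h, Sym2.mem_mk_left _ _⟩
    · intro f hf'
      simp only [SimpleGraph.Walk.edges_cons, List.mem_cons] at hf'
      rcases hf' with rfl | rfl | hf'
      · simp [hauM, hf]
      · simp [hg, hucN]
      · rw [← hag f hf']
        exact hpe f hf'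
  · refine ⟨u, .cons hab .nil, ⟨?_, by simp, haM, hu, ?_⟩, ?_⟩
    · simp [hab.ne]
    · intro i hi
      simp at hi
    · simp [hauM, hf]

/-- An augmenting path with respect to `M` followed by one with respect to the augmented matching
can be replaced by two edge-disjoint augmenting paths with respect to `M` of no larger total
length. -/
theorem IsAugPath.exists_disjoint {V : Type*} {G : SimpleGraph V} {M M' : Finset (Sym2 V)}
    (hM : IsMatching G M) {a b c d : V} {P : G.Walk a b} (hP : IsAugPath G M P)
    (hM' : ∀ f, f ∈ M' ↔ ¬ (f ∈ M ↔ f ∈ P.edges)) {Q : G.Walk c d} (hQ : IsAugPath G M' Q) :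
    ∃ (x y z w : V) (p : G.Walk x y) (q : G.Walk z w), IsAugPath G M p ∧ IsAugPath G M q ∧
      List.Disjoint p.edges q.edges ∧ p.length + q.length ≤ P.length + Q.length := by
  obtain ⟨hM'm, hM'v⟩ := hP.isMatching_symmDiff hM hM'
  obtain ⟨N, hN⟩ : ∃ N : Finset (Sym2 V), ∀ f, f ∈ N ↔ ¬ (f ∈ M' ↔ f ∈ Q.edges) := by
    refine ⟨M' ∆ Q.edges.toFinset, fun f => ?_⟩
    simp only [Finset.mem_symmDiff, List.mem_toFinset]
    tauto
  obtain ⟨hNm, hNv⟩ := hQ.isMatching_symmDiff hM'm hN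
  obtain ⟨y, p, hp, hpe⟩ := hM.exists_isAugPath hNm (fun v hv => by grind) hP.expA (by grind)
  obtain ⟨L, hL⟩ : ∃ L : Finset (Sym2 V), ∀ f, f ∈ L ↔ ¬ (f ∈ M ↔ f ∈ p.edges) := by
    refine ⟨M ∆ p.edges.toFinset, fun f => ?_⟩
    simp only [Finset.mem_symmDiff, List.mem_toFinset]
    tauto
  obtain ⟨hLm, hLv⟩ := hp.isMatching_symmDiff hM hL
  have hyN : Matched N y := by
    have hnil : ¬ p.Nil := by
      rw [← SimpleGraph.Walk.length_eq_zero_iff]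
      exact hp.pos.ne'
    obtain ⟨f, hfp, hyf⟩ :=
      (SimpleGraph.Walk.mem_support_iff_exists_mem_edges_of_not_nil hnil).1 p.end_mem_support
    refine ⟨f, ?_, hyf⟩
    have : f ∉ M := fun h => hp.expB ⟨f, h, hyf⟩
    have := hpe f hfp
    tauto
  obtain ⟨z, hzL, hzN⟩ : ∃ z, ¬ Matched L z ∧ Matched N z := by
    have hcd := hQ.ne
    have hc := hQ.expA
    have hd := hQ.expB
    by_cases hy : y = c
    · exact ⟨d, by grind, by grind⟩
    · exact ⟨c, by grind, by grind⟩
  obtain ⟨w, q, hq, hqe⟩ := hLm.exists_isAugPath hNm (fun v hv => by grind) hzL hzN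
  have hdisj : List.Disjoint p.edges q.edges := by
    intro f hfp hfq
    have h1 := hpe f hfp
    have h2 := hqe f hfq
    have h3 := hL f
    tauto
  refine ⟨a, y, z, w, p, q, hp, ⟨hq.isPath, hq.pos, ?_, ?_, ?_⟩, hdisj, ?_⟩
  · exact fun h => hq.expA ((hLv z).2 (Or.inl h))
  · exact fun h => hq.expB ((hLv w).2 (Or.inl h))
  · refine hq.alt.congr fun f hf => ?_
    have h1 : f ∉ p.edges := fun h => hdisj h hf
    rw [hL]
    tauto
  · have hnd : (p.edges ++ q.edges).Nodup :=
      List.nodup_append'.2 ⟨hp.isPath.isTrail.edges_nodup, hq.isPath.isTrail.edges_nodup, hdisj⟩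
    have hsub : p.edges ++ q.edges ⊆ P.edges ++ Q.edges := by
      intro f hf
      rw [List.mem_append] at hf ⊢
      have hMN : ¬ (f ∈ M ↔ f ∈ N) := by
        rcases hf with hf | hf
        · exact hpe f hf
        · have h1 := hqe f hf
          rwa [show f ∈ L ↔ f ∈ M by
            have := hL f
            have : f ∉ p.edges := fun h => hdisj h hf
            tauto] at h1
      by_contra h
      have h1 := hN f
      have h2 := hM' f
      simp_all
    simpa using (List.subperm_of_subset hnd hsub).length_le

/-- Edge-arrival invariant step: let `M` be a matching, `k` a positive even
integer, and `e` an edge of `G`. If every augmenting path with respect to `M` not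
containing the edge `e` has length at least `k + 1`, and `P` is an augmenting
path with respect to `M` containing `e`, of length at most `k - 1`, and of
minimum length among all augmenting paths with respect to `M` containing `e`,
then every augmenting path with respect to `M △ P` has length at least `k + 1`. -/
theorem stmt8 {V : Type*} [Fintype V] [DecidableEq V] (G : SimpleGraph V)
    (M : Finset (Sym2 V)) (hM : IsMatching G M)
    (k : ℕ) (hk0 : 0 < k) (hk2 : Even k)
    (e : Sym2 V) (he : e ∈ G.edgeSet)
    (hothers : ∀ (x y : V) (q : G.Walk x y), IsAugPath G M q → e ∉ q.edges →
      k + 1 ≤ q.length)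
    {a b : V} (P : G.Walk a b) (hP : IsAugPath G M P) (heP : e ∈ P.edges)
    (hlen : P.length ≤ k - 1)
    (hmin : ∀ (x y : V) (q : G.Walk x y), IsAugPath G M q → e ∈ q.edges →
      P.length ≤ q.length) :
    ∀ (c d : V) (Q : G.Walk c d), IsAugPath G (M ∆ P.edges.toFinset) Q →
      k + 1 ≤ Q.length := by
  intro c d Q hQ
  obtain ⟨x, y, z, w, p, q, hp, hq, hdisj, hle⟩ := hP.exists_disjoint hM (fun f => by
    simp only [Finset.mem_symmDiff, List.mem_toFinset]
    tauto) hQ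
  by_cases hep : e ∈ p.edges
  · have h1 := hmin _ _ p hp hep
    have h2 := hothers _ _ q hq fun h => hdisj hep h
    omega
  · have h1 := hothers _ _ p hp hep
    by_cases heq : e ∈ q.edges
    · have h2 := hmin _ _ q hq heq
      omega
    · have h2 := hothers _ _ q hq heq
      omega
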